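/- arXiv:2202.01950 — 3 statements merged into one kernel-verified Lean document; each statement's English description precedes it below -/
import Mathlib

section
/- Let X be a nonempty finite type and let p, q : X → ℝ be strictly positive functions (p x > 0 and q x > 0 for all x). Then for every function D : X → ℝ with 0 < D x < 1 for all x, one has Σ_x [p x · log(D x) + q x · log(1 − D x)] ≤ Σ_x [p x · log(p x/(p x + q x)) + q x · log(q x/(p x + q x))]; that is, the comparator D*(x) = p x/(p x + q x) maximizes the adversarial cross-entropy objective over all comparators D : X → (0,1). -/
open Finset

/-- The tangent-line bound for `log` at `a / s`, scaled by `a`. -/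
theorem mul_log_le_mul_log_div_add {a s d : ℝ} (ha : 0 < a) (hs : 0 < s) (hd : 0 < d) :
    a * Real.log d ≤ a * Real.log (a / s) + (d * s - a) := by
  have has : 0 < a / s := div_pos ha hs
  have h := mul_le_mul_of_nonneg_left (Real.log_le_sub_one_of_pos (div_pos hd has)) ha.le
  rw [Real.log_div hd.ne' has.ne'] at h
  have e : a * (d / (a / s) - 1) = d * s - a := by field_simp
  linarith

/-- Gibbs' inequality for two outcomes with unnormalized positive weights. -/
theorem mul_log_add_mul_log_one_sub_le {a b d : ℝ} (ha : 0 < a) (hb : 0 < b)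
    (hd0 : 0 < d) (hd1 : d < 1) :
    a * Real.log d + b * Real.log (1 - d) ≤
      a * Real.log (a / (a + b)) + b * Real.log (b / (a + b)) := by
  have h₁ := mul_log_le_mul_log_div_add ha (add_pos ha hb) hd0
  have h₂ := mul_log_le_mul_log_div_add hb (add_pos ha hb) (sub_pos.2 hd1)
  linarith

/-- Optimal comparator on a finite type: for strictly positive `p, q`, the
comparator `D*(x) = p x / (p x + q x)` maximizes the adversarial cross-entropy
objective over all comparators `D : X → (0,1)`. -/
theorem optimal_comparator_finite (X : Type*) [Fintype X] [Nonempty X]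
    (p q : X → ℝ) (hp : ∀ x, 0 < p x) (hq : ∀ x, 0 < q x)
    (D : X → ℝ) (hD0 : ∀ x, 0 < D x) (hD1 : ∀ x, D x < 1) :
    ∑ x, (p x * Real.log (D x) + q x * Real.log (1 - D x)) ≤
      ∑ x, (p x * Real.log (p x / (p x + q x)) +
        q x * Real.log (q x / (p x + q x))) := by
  exact sum_le_sum fun x _ =>
    mul_log_add_mul_log_one_sub_le (hp x) (hq x) (hD0 x) (hD1 x)
end

section
/- Let X be a nonempty finite type and let p, q : X → ℝ be strictly positive probability mass functions on X (p x > 0, q x > 0 for all x, Σ_x p x = 1, Σ_x q x = 1). Then the optimal-comparator value C(p,q) = Σ_x [p x · log(p x/(p x + q x)) + q x · log(q x/(p x + q x))] satisfies C(p,q) ≥ −log 4, with equality if and only if q = p. -/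
open Finset

theorem mul_log_div_add_ge {a b : ℝ} (ha : 0 < a) (hb : 0 < b) :
    (a - b) / 2 - a * Real.log 2 ≤ a * Real.log (a / (a + b)) ∧
      (a ≠ b → (a - b) / 2 - a * Real.log 2 < a * Real.log (a / (a + b))) := by
  have hpos : 0 < (a + b) / (2 * a) := by positivity
  have hlog : Real.log (a / (a + b)) = -Real.log 2 - Real.log ((a + b) / (2 * a)) := by
    rw [Real.log_div ha.ne' (by positivity), Real.log_div (by positivity) (by positivity),
      Real.log_mul two_ne_zero ha.ne']
    ring
  have hmul : a * ((a + b) / (2 * a) - 1) = (b - a) / 2 := by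
    field_simp
    ring
  rw [hlog]
  constructor
  · have h := mul_le_mul_of_nonneg_left (Real.log_le_sub_one_of_pos hpos) ha.le
    linarith
  · intro hab
    have hne : (a + b) / (2 * a) ≠ 1 := by
      intro h
      rw [div_eq_one_iff_eq (by positivity)] at h
      exact hab (by linarith)
    have h := mul_lt_mul_of_pos_left (Real.log_lt_sub_one_of_pos hpos hne) ha
    linarith

theorem comparator_term_ge {a b : ℝ} (ha : 0 < a) (hb : 0 < b) :
    -Real.log 2 * (a + b) ≤ a * Real.log (a / (a + b)) + b * Real.log (b / (a + b)) := by
  have h₁ := (mul_log_div_add_ge ha hb).1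
  have h₂ := (mul_log_div_add_ge hb ha).1
  rw [add_comm b a] at h₂
  linarith

theorem comparator_term_gt {a b : ℝ} (ha : 0 < a) (hb : 0 < b) (hab : a ≠ b) :
    -Real.log 2 * (a + b) < a * Real.log (a / (a + b)) + b * Real.log (b / (a + b)) := by
  have h₁ := (mul_log_div_add_ge ha hb).2 hab
  have h₂ := (mul_log_div_add_ge hb ha).1
  rw [add_comm b a] at h₂
  linarith

/-- The optimal-comparator value `C(p,q)` is bounded below by `-log 4`, with
equality if and only if `q = p`. -/
theorem optimal_comparator_value_ge (X : Type*) [Fintype X] [Nonempty X]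
    (p q : X → ℝ) (hp : ∀ x, 0 < p x) (hq : ∀ x, 0 < q x)
    (hp1 : ∑ x, p x = 1) (hq1 : ∑ x, q x = 1) :
    -Real.log 4 ≤ ∑ x, (p x * Real.log (p x / (p x + q x)) +
        q x * Real.log (q x / (p x + q x))) ∧
      (∑ x, (p x * Real.log (p x / (p x + q x)) +
        q x * Real.log (q x / (p x + q x))) = -Real.log 4 ↔ q = p) := by
  have hlog : Real.log 4 = 2 * Real.log 2 := by
    rw [show (4 : ℝ) = 2 ^ 2 by norm_num, Real.log_pow]
    norm_num
  have hsum : ∑ x, -Real.log 2 * (p x + q x) = -Real.log 4 := by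
    rw [← Finset.mul_sum, Finset.sum_add_distrib, hp1, hq1, hlog]
    ring
  rw [← hsum]
  refine ⟨Finset.sum_le_sum fun x _ => comparator_term_ge (hp x) (hq x), fun h => ?_, ?_⟩
  · by_contra hne
    obtain ⟨x, hx⟩ := Function.ne_iff.mp hne
    exact (Finset.sum_lt_sum (fun y _ => comparator_term_ge (hp y) (hq y))
      ⟨x, Finset.mem_univ x, comparator_term_gt (hp x) (hq x) hx.symm⟩).ne' h
  · rintro rfl
    refine Finset.sum_congr rfl fun x _ => ?_
    have hx : q x / (q x + q x) = 2⁻¹ := by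
      have := (hq x).ne'
      field_simp
      norm_num
    rw [hx, Real.log_inv]
    ring
end

section
/- Let X be a nonempty finite type and let p : X → ℝ be a strictly positive probability mass function (p x > 0 for all x, Σ_x p x = 1). Suppose q : X → ℝ is a strictly positive probability mass function that minimizes, over all strictly positive probability mass functions q' on X, the quantity C(p,q') = Σ_x [p x · log(p x/(p x + q' x)) + q' x · log(q' x/(p x + q' x))] (i.e., C(p,q) ≤ C(p,q') for all such q'). Then q = p. -/
open Finset

/-- The integrand of the optimal-comparator value is strictly larger than its value on the
diagonal with the same total mass. -/
lemma neg_add_mul_log_two_lt {a b : ℝ} (ha : 0 < a) (hb : 0 < b) (hab : b ≠ a) :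
    -(a + b) * Real.log 2 <
      a * Real.log (a / (a + b)) + b * Real.log (b / (a + b)) := by
  have key : ∀ {c d : ℝ}, 0 < c → 0 < d → d ≠ c →
      (c - d) / 2 < c * (Real.log (c / (c + d)) + Real.log 2) := by
    intro c d hc hd hcd
    have hlog : Real.log (c / (c + d)) + Real.log 2 = -Real.log ((c + d) / (2 * c)) := by
      rw [← Real.log_mul (by positivity) (by norm_num), ← Real.log_inv]
      congr 1
      field_simp
    have hne : (c + d) / (2 * c) ≠ 1 := by
      rw [Ne, div_eq_one_iff_eq (by positivity)]
      intro h
      exact hcd (by linarith)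
    have hlt := mul_lt_mul_of_pos_left
      (Real.log_lt_sub_one_of_pos (by positivity : 0 < (c + d) / (2 * c)) hne) hc
    have hval : c * ((c + d) / (2 * c) - 1) = (d - c) / 2 := by
      field_simp
      ring
    rw [hlog]
    linarith
  have h₁ := key ha hb hab
  have h₂ := key hb ha hab.symm
  rw [add_comm b a] at h₂
  linarith

lemma mul_log_half_add_self {a : ℝ} (ha : 0 < a) :
    a * Real.log (a / (a + a)) + a * Real.log (a / (a + a)) = -(a + a) * Real.log 2 := by
  have h : a / (a + a) = 2⁻¹ := by
    field_simp
    norm_num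
  rw [h, Real.log_inv]
  ring

/-- Theorem 1 of the paper: if `q` minimizes the optimal-comparator value
`C(p, ·)` over all strictly positive probability mass functions on `X`,
then `q = p`. -/
theorem generator_optimum_is_expert (X : Type*) [Fintype X] [Nonempty X]
    (p : X → ℝ) (hp : ∀ x, 0 < p x) (hp1 : ∑ x, p x = 1)
    (q : X → ℝ) (hq : ∀ x, 0 < q x) (hq1 : ∑ x, q x = 1)
    (hmin : ∀ q' : X → ℝ, (∀ x, 0 < q' x) → ∑ x, q' x = 1 →
      ∑ x, (p x * Real.log (p x / (p x + q x)) +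
          q x * Real.log (q x / (p x + q x))) ≤
        ∑ x, (p x * Real.log (p x / (p x + q' x)) +
          q' x * Real.log (q' x / (p x + q' x)))) :
    q = p := by
  by_contra hne
  obtain ⟨x₀, hx₀⟩ := Function.ne_iff.mp hne
  have hlt : ∑ x, -(p x + q x) * Real.log 2 <
      ∑ x, (p x * Real.log (p x / (p x + q x)) + q x * Real.log (q x / (p x + q x))) := by
    refine Finset.sum_lt_sum (fun x _ => ?_)
      ⟨x₀, Finset.mem_univ x₀, neg_add_mul_log_two_lt (hp x₀) (hq x₀) hx₀⟩
    by_cases hx : q x = p x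
    · rw [hx, mul_log_half_add_self (hp x)]
    · exact (neg_add_mul_log_two_lt (hp x) (hq x) hx).le
  have hle := hmin p hp hp1
  simp_rw [fun x => mul_log_half_add_self (hp x)] at hle
  have hmass : ∑ x, -(p x + q x) * Real.log 2 = ∑ x, -(p x + p x) * Real.log 2 := by
    simp only [← Finset.sum_mul, Finset.sum_neg_distrib, Finset.sum_add_distrib, hp1, hq1]
  linarith
end
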